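/- For all A ≤ 0 ≤ B, the worst-case alternative lower-crossing probability of the sequential t-test statistic is bounded by a standard normal t-statistic crossing probability: sup over μ ≥ δ and σ > 0 of P_{μ,σ}(∃n ≥ 2: Λ(n) ≤ A and Λ(n′) < B for all 2 ≤ n′ < n) ≤ P(∃n ≥ 2: T_n ≤ a_n and T_{n′} < b_{n′} for all 2 ≤ n′ < n), where a_n = −√((n−1)(e^{(A/n)²}−1)) and b_n = √((n−1)(e^{(B/n)²}−1)). -/

import Mathlib

open MeasureTheory ProbabilityTheory Finset NNReal

/-- The sample mean `ȳ_n = n⁻¹ Σ_{j=1}^n y_j`. -/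
noncomputable def sampleMean (n : ℕ) (y : ℕ → ℝ) : ℝ := (n : ℝ)⁻¹ * ∑ j ∈ range n, y j

/-- The maximum likelihood variance estimate `σ̂_n² = n⁻¹ Σ_{j=1}^n (y_j − ȳ_n)²`. -/
noncomputable def mleVar (n : ℕ) (y : ℕ → ℝ) : ℝ :=
  (n : ℝ)⁻¹ * ∑ j ∈ range n, (y j - sampleMean n y) ^ 2

/-- The signed-root generalized likelihood ratio statistic of the sequential t-test:
`Λ(n) = +√(2nΛ_H(n))` if `ȳ_n ≥ δ/2` and `Λ(n) = −√(2nΛ_G(n))` otherwise, where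
`Λ_H(n) = (n/2)·log(1 + (ȳ_n/σ̂_n)²)` and `Λ_G(n) = (n/2)·log(1 + ((ȳ_n−δ)/σ̂_n)²)`. -/
noncomputable def signedRootGLR (δ : ℝ) (n : ℕ) (y : ℕ → ℝ) : ℝ :=
  if δ / 2 ≤ sampleMean n y then
    Real.sqrt (2 * n * ((n : ℝ) / 2 * Real.log (1 + (sampleMean n y) ^ 2 / mleVar n y)))
  else
    -Real.sqrt (2 * n * ((n : ℝ) / 2 * Real.log (1 + (sampleMean n y - δ) ^ 2 / mleVar n y)))

/-- The unbiased variance estimate `Σ_n = (n−1)⁻¹ Σ_{j=1}^n (y_j − ȳ_n)²`. -/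
noncomputable def unbiasedVar (n : ℕ) (y : ℕ → ℝ) : ℝ :=
  ((n : ℝ) - 1)⁻¹ * ∑ j ∈ range n, (y j - sampleMean n y) ^ 2

/-- The one-sample t-statistic `T_n = ȳ_n/√(Σ_n/n)`. -/
noncomputable def tStatistic (n : ℕ) (y : ℕ → ℝ) : ℝ :=
  sampleMean n y / Real.sqrt (unbiasedVar n y / n)

/-- The event, in sequence space, that the t-statistic crosses the lower boundary
before reaching the upper one. -/
def tCrossing (A B : ℝ) : Set (ℕ → ℝ) :=
  {z | ∃ n : ℕ, 2 ≤ n ∧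
    tStatistic n z ≤ -Real.sqrt (((n : ℝ) - 1) * (Real.exp ((A / n) ^ 2) - 1)) ∧
    ∀ n', 2 ≤ n' → n' < n →
      tStatistic n' z < Real.sqrt (((n' : ℝ) - 1) * (Real.exp ((B / n') ^ 2) - 1))}

lemma measurable_sampleMean (n : ℕ) : Measurable (sampleMean n) := by
  unfold sampleMean
  fun_prop

lemma measurable_tStatistic (n : ℕ) : Measurable (tStatistic n) := by
  have := measurable_sampleMean n
  unfold tStatistic unbiasedVar
  fun_prop

lemma measurableSet_tCrossing (A B : ℝ) : MeasurableSet (tCrossing A B) := by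
  have h := measurable_tStatistic
  unfold tCrossing
  simp only [Set.ofPred_exists, Set.ofPred_and, Set.ofPred_forall]
  refine .iUnion fun n => (MeasurableSet.const _).inter
    ((measurableSet_le (h n) measurable_const).inter ?_)
  exact .iInter fun n' => .iInter fun _ => .iInter fun _ =>
    measurableSet_lt (h n') measurable_const

lemma sampleMean_standardize {n : ℕ} (hn : n ≠ 0) (m s : ℝ) (y : ℕ → ℝ) :
    sampleMean n (fun j => (y j - m) / s) = (sampleMean n y - m) / s := by
  have : (n : ℝ) ≠ 0 := Nat.cast_ne_zero.2 hn
  simp only [sampleMean, ← Finset.sum_div, Finset.sum_sub_distrib, Finset.sum_const,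
    Finset.card_range, nsmul_eq_mul]
  field_simp

lemma mleVar_nonneg (n : ℕ) (y : ℕ → ℝ) : 0 ≤ mleVar n y := by
  unfold mleVar
  positivity

lemma unbiasedVar_standardize {n : ℕ} (hn : n ≠ 0) (m s : ℝ) (y : ℕ → ℝ) :
    unbiasedVar n (fun j => (y j - m) / s) / n = mleVar n y / ((n : ℝ) - 1) / s ^ 2 := by
  have h : ∀ j, ((y j - m) / s - (sampleMean n y - m) / s) ^ 2 =
      (y j - sampleMean n y) ^ 2 / s ^ 2 := fun j => by ring
  simp only [unbiasedVar, mleVar, sampleMean_standardize hn, h, ← Finset.sum_div]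
  ring

lemma tStatistic_standardize {n : ℕ} (hn : n ≠ 0) (m : ℝ) {s : ℝ} (hs : 0 < s) (y : ℕ → ℝ) :
    tStatistic n (fun j => (y j - m) / s) =
      (sampleMean n y - m) / Real.sqrt (mleVar n y / ((n : ℝ) - 1)) := by
  rw [tStatistic, sampleMean_standardize hn, unbiasedVar_standardize hn,
    Real.sqrt_div' _ (sq_nonneg s), Real.sqrt_sq hs.le, div_div_div_cancel_right₀ hs.ne']

lemma sqrt_glr_eq (n : ℕ) (L : ℝ) :
    Real.sqrt (2 * n * ((n : ℝ) / 2 * L)) = n * Real.sqrt L := by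
  rw [show 2 * (n : ℝ) * ((n : ℝ) / 2 * L) = (n : ℝ) ^ 2 * L by ring,
    Real.sqrt_mul (sq_nonneg _), Real.sqrt_sq (Nat.cast_nonneg n)]

lemma tStatistic_le_of_signedRootGLR_le {δ m s A : ℝ} {n : ℕ} (hn : 2 ≤ n) (hδ : 0 < δ)
    (hm : δ ≤ m) (hs : 0 < s) (hA : A ≤ 0) (y : ℕ → ℝ) (h : signedRootGLR δ n y ≤ A) :
    tStatistic n (fun j => (y j - m) / s) ≤
      -Real.sqrt (((n : ℝ) - 1) * (Real.exp ((A / n) ^ 2) - 1)) := by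
  have hn2 : (2 : ℝ) ≤ n := by exact_mod_cast hn
  have hn0 : (0 : ℝ) < n := by linarith
  have hn1 : (0 : ℝ) < (n : ℝ) - 1 := by linarith
  rw [tStatistic_standardize (by omega) m hs]
  rw [signedRootGLR, sqrt_glr_eq, sqrt_glr_eq] at h
  have hv := mleVar_nonneg n y
  set v := mleVar n y
  set u := sampleMean n y
  rcases hv.eq_or_lt with hv0 | hv0
  · have : A = 0 := le_antisymm hA (by simpa [← hv0] using h)
    simp [← hv0, this]
  split_ifs at h with hu
  · have hpos : 0 < Real.log (1 + u ^ 2 / v) := by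
      have : 0 < u := by linarith
      exact Real.log_pos (by simpa using by positivity)
    have : 0 < (n : ℝ) * Real.sqrt (Real.log (1 + u ^ 2 / v)) := by positivity
    linarith
  · push Not at hu
    have hL : (A / n) ^ 2 ≤ Real.log (1 + (u - δ) ^ 2 / v) := by
      have h1 : -A / n ≤ Real.sqrt (Real.log (1 + (u - δ) ^ 2 / v)) := by
        rw [div_le_iff₀ hn0]
        linarith
      have h2 := (Real.le_sqrt' (x := -A / n)
        (y := Real.log (1 + (u - δ) ^ 2 / v)))
      rcases hA.eq_or_lt with rfl | hA'
      · simpa using Real.log_nonneg (by simpa using by positivity)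
      · simpa [neg_div] using (h2 (div_pos (by linarith) hn0)).1 h1
    have hE : Real.exp ((A / n) ^ 2) - 1 ≤ (u - δ) ^ 2 / v := by
      have := (Real.le_log_iff_exp_le (by positivity)).1 hL
      linarith
    have hum : (u - δ) ^ 2 ≤ (m - u) ^ 2 := by nlinarith
    have hk : (0 : ℝ) < v / ((n : ℝ) - 1) := by positivity
    rw [← neg_sub m u, neg_div, neg_le_neg_iff]
    refine Real.sqrt_le_iff.2 ⟨div_nonneg (by linarith) (Real.sqrt_nonneg _), ?_⟩
    rw [div_pow (m - u), Real.sq_sqrt hk.le]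
    calc ((n : ℝ) - 1) * (Real.exp ((A / n) ^ 2) - 1)
        ≤ ((n : ℝ) - 1) * ((m - u) ^ 2 / v) := by
          gcongr
          exact hE.trans (by gcongr)
      _ = (m - u) ^ 2 / (v / ((n : ℝ) - 1)) := by field_simp

lemma tStatistic_lt_of_signedRootGLR_lt {δ m s B : ℝ} {n : ℕ} (hn : 2 ≤ n) (hδ : 0 < δ)
    (hm : δ ≤ m) (hs : 0 < s) (y : ℕ → ℝ) (h : signedRootGLR δ n y < B) :
    tStatistic n (fun j => (y j - m) / s) <
      Real.sqrt (((n : ℝ) - 1) * (Real.exp ((B / n) ^ 2) - 1)) := by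
  have hn2 : (2 : ℝ) ≤ n := by exact_mod_cast hn
  have hn0 : (0 : ℝ) < n := by linarith
  have hn1 : (0 : ℝ) < (n : ℝ) - 1 := by linarith
  rw [tStatistic_standardize (by omega) m hs]
  rw [signedRootGLR, sqrt_glr_eq, sqrt_glr_eq] at h
  have hv := mleVar_nonneg n y
  set v := mleVar n y
  set u := sampleMean n y
  have hbound : 0 < B → 0 < Real.sqrt (((n : ℝ) - 1) * (Real.exp ((B / n) ^ 2) - 1)) := by
    intro hB'
    have : 0 < Real.exp ((B / n) ^ 2) - 1 := by
      simpa using hB'.ne'.imp_symm (by simp [hn0.ne'])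
    positivity
  rcases hv.eq_or_lt with hv0 | hv0
  · have : 0 < B := by simpa [← hv0] using h
    simpa [← hv0] using hbound this
  have hk : (0 : ℝ) < v / ((n : ℝ) - 1) := by positivity
  rcases lt_or_ge u m with hum | hum
  · exact (div_neg_of_neg_of_pos (by linarith) (Real.sqrt_pos.2 hk)).trans_le
      (Real.sqrt_nonneg _)
  · rw [if_pos (by linarith)] at h
    have hL : Real.log (1 + u ^ 2 / v) < (B / n) ^ 2 := by
      refine (Real.sqrt_lt' ?_).1 ((lt_div_iff₀' hn0).2 h)
      exact div_pos (lt_of_le_of_lt (by positivity) h) hn0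
    have hE : u ^ 2 / v < Real.exp ((B / n) ^ 2) - 1 := by
      have := (Real.log_lt_iff_lt_exp (by positivity)).1 hL
      linarith
    have hsq : (u - m) ^ 2 ≤ u ^ 2 := by nlinarith
    refine Real.lt_sqrt_of_sq_lt ?_
    rw [div_pow, Real.sq_sqrt hk.le]
    calc (u - m) ^ 2 / (v / ((n : ℝ) - 1)) = ((n : ℝ) - 1) * ((u - m) ^ 2 / v) := by field_simp
      _ ≤ ((n : ℝ) - 1) * (u ^ 2 / v) := by gcongr
      _ < _ := by gcongr

lemma gaussianReal_map_standardize (m : ℝ) {σ : ℝ≥0} (hσ : 0 < σ) :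
    (gaussianReal m (σ ^ 2)).map (fun x => (x - m) / σ) = gaussianReal 0 1 := by
  have h : (fun x : ℝ => (x - m) / σ) = (fun x => x / (σ : ℝ)) ∘ fun x => x - m := rfl
  rw [h, ← Measure.map_map (by fun_prop) (by fun_prop), gaussianReal_map_sub_const,
    gaussianReal_map_div_const, sub_self, zero_div]
  congr 1
  ext
  have : (σ : ℝ) ≠ 0 := by exact_mod_cast hσ.ne'
  simp [this]

/-- Two independent sequences with the same marginals have the same law. -/
lemma map_eq_map_of_iIndepFun {Ω Ω' : Type*} [MeasurableSpace Ω] [MeasurableSpace Ω']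
    {P : Measure Ω} [IsProbabilityMeasure P] {P' : Measure Ω'} [IsProbabilityMeasure P']
    {Y : ℕ → Ω → ℝ} {Z : ℕ → Ω' → ℝ} (hY : ∀ j, Measurable (Y j)) (hZ : ∀ j, Measurable (Z j))
    (hYindep : iIndepFun Y P) (hZindep : iIndepFun Z P')
    (h : ∀ j, P.map (Y j) = P'.map (Z j)) :
    P.map (fun ω j => Y j ω) = P'.map (fun ω j => Z j ω) := by
  rw [(iIndepFun_iff_map_fun_eq_infinitePi_map hY).1 hYindep,
    (iIndepFun_iff_map_fun_eq_infinitePi_map hZ).1 hZindep]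
  simp only [h]

/-- For all `A ≤ 0 ≤ B`, the worst-case alternative lower-crossing probability of the
sequential t-test statistic (data i.i.d. `Normal(m, σ²)` with `m ≥ δ`, `σ > 0`) is bounded by
the corresponding crossing probability of the one-sample t-statistic of i.i.d. standard Normal
data, with boundaries `a_n = −√((n−1)(e^{(A/n)²}−1))` and `b_n = √((n−1)(e^{(B/n)²}−1))`. -/
theorem seq_t_test_typeII_bound {Ω Ω' : Type*} [MeasurableSpace Ω] [MeasurableSpace Ω']
    (P : Measure Ω) [IsProbabilityMeasure P] (P' : Measure Ω') [IsProbabilityMeasure P']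
    (δ : ℝ) (hδ : 0 < δ) (m : ℝ) (σ : ℝ≥0) (hm : δ ≤ m) (hσ : 0 < σ)
    (X : ℕ → Ω → ℝ) (hX : ∀ j, Measurable (X j))
    (hXindep : iIndepFun X P)
    (hXdist : ∀ j, P.map (X j) = gaussianReal m (σ ^ 2))
    (Z : ℕ → Ω' → ℝ) (hZ : ∀ j, Measurable (Z j))
    (hZindep : iIndepFun Z P')
    (hZdist : ∀ j, P'.map (Z j) = gaussianReal 0 1)
    (A B : ℝ) (hA : A ≤ 0) (hB : 0 ≤ B) :
    P {ω | ∃ n : ℕ, 2 ≤ n ∧ signedRootGLR δ n (fun j => X j ω) ≤ A ∧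
        ∀ n', 2 ≤ n' → n' < n → signedRootGLR δ n' (fun j => X j ω) < B} ≤
    P' {ω | ∃ n : ℕ, 2 ≤ n ∧
        tStatistic n (fun j => Z j ω) ≤
          -Real.sqrt (((n : ℝ) - 1) * (Real.exp ((A / n) ^ 2) - 1)) ∧
        ∀ n', 2 ≤ n' → n' < n →
          tStatistic n' (fun j => Z j ω) <
            Real.sqrt (((n' : ℝ) - 1) * (Real.exp ((B / n') ^ 2) - 1))} := by
  have hσ' : (0 : ℝ) < σ := by exact_mod_cast hσ
  have hstd : Measurable fun x : ℝ => (x - m) / σ := by fun_prop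
  have hY : ∀ j, Measurable fun ω => (X j ω - m) / σ := fun j => hstd.comp (hX j)
  have hlaw : P.map (fun ω j => (X j ω - m) / σ) = P'.map (fun ω j => Z j ω) := by
    refine map_eq_map_of_iIndepFun hY hZ (hXindep.comp _ fun _ => hstd) hZindep fun j => ?_
    rw [hZdist, ← gaussianReal_map_standardize m hσ, ← hXdist j, Measure.map_map hstd (hX j)]
    rfl
  have hE := measurableSet_tCrossing A B
  calc _ ≤ P ((fun ω j => (X j ω - m) / σ) ⁻¹' tCrossing A B) := by
        refine measure_mono ?_
        rintro ω ⟨n, hn, hnA, hnB⟩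
        exact ⟨n, hn, tStatistic_le_of_signedRootGLR_le hn hδ hm hσ' hA _ hnA,
          fun n' hn' hlt => tStatistic_lt_of_signedRootGLR_lt hn' hδ hm hσ' _ (hnB n' hn' hlt)⟩
    _ = P' ((fun ω j => Z j ω) ⁻¹' tCrossing A B) := by
        rw [← Measure.map_apply (measurable_pi_lambda _ hY) hE, hlaw,
          Measure.map_apply (measurable_pi_lambda _ hZ) hE]
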